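/- In the random-environment setup with a stationary, ergodic random environment η and a random walk X in the 'have your cookie and eat it' environment η started at 1, suppose that the expectation E_𝒫[ω(0)/(1 − ω(0))] of ω(0)/(1 − ω(0)) under the environment law 𝒫 is strictly greater than 2 (possibly infinite). Then lim_{n→∞} X_n = +∞ almost surely, and the conditional probability E[1_{{T_0 = ∞}} | σ(η)] is almost surely strictly positive; that is, for 𝒫-almost every environment the quenched process is transient. -/

import Mathlib

open MeasureTheory Filter

noncomputable section

/-- The hitting time of site `x` by the process `X`, with value `⊤` if `x` is never hit. -/
def hitTime {Ω : Type*} (X : ℕ → Ω → ℤ) (x : ℤ) (ω : Ω) : ℕ∞ :=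
  ⨅ (n : ℕ) (_ : X n ω = x), (n : ℕ∞)

/-- The natural filtration of the process `X` at time `n`. -/
def natSA {Ω : Type*} (X : ℕ → Ω → ℤ) (n : ℕ) : MeasurableSpace Ω :=
  ⨆ m ∈ Finset.range (n + 1), MeasurableSpace.comap (X m) ⊤

/-- The event `A_n` that before time `n` the walk has never jumped leftward from its
current site `X_n`. -/
def freshEvent {Ω : Type*} (X : ℕ → Ω → ℤ) (n : ℕ) : Set Ω :=
  {ω | ∀ m < n, ¬(X m ω = X n ω ∧ X (m + 1) ω = X m ω - 1)}

/-- A random walk in the "have your cookie and eat it" environment `env`. -/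
structure IsCookieRW {Ω : Type*} [MeasurableSpace Ω] (P : Measure Ω)
    (env : ℤ → ℝ) (X : ℕ → Ω → ℤ) : Prop where
  envRange : ∀ x : ℤ, env x ∈ Set.Ico (1 / 2 : ℝ) 1
  meas : ∀ n, Measurable (X n)
  steps : ∀ n : ℕ, ∀ᵐ ω ∂P, |X (n + 1) ω - X n ω| = 1
  cond : ∀ n : ℕ,
    (P[Set.indicator {ω | X (n + 1) ω = X n ω + 1} (fun _ => (1 : ℝ)) | natSA X n])
      =ᵐ[P]
    fun ω => env (X n ω) * Set.indicator (freshEvent X n) (fun _ => (1 : ℝ)) ω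
      + (1 / 2) * Set.indicator (freshEvent X n)ᶜ (fun _ => (1 : ℝ)) ω

/-- A random walk in a random "have your cookie and eat it" environment `η`. -/
structure IsCookieRWRE {Ω : Type*} [MeasurableSpace Ω] (P : Measure Ω)
    (η : Ω → ℤ → ℝ) (X : ℕ → Ω → ℤ) : Prop where
  envMeas : Measurable η
  envRange : ∀ᵐ ω ∂P, ∀ x : ℤ, η ω x ∈ Set.Ico (1 / 2 : ℝ) 1
  meas : ∀ n, Measurable (X n)
  steps : ∀ n : ℕ, ∀ᵐ ω ∂P, |X (n + 1) ω - X n ω| = 1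
  cond : ∀ n : ℕ,
    (P[Set.indicator {ω | X (n + 1) ω = X n ω + 1} (fun _ => (1 : ℝ)) |
        MeasurableSpace.comap η inferInstance ⊔ natSA X n])
      =ᵐ[P]
    fun ω => η ω (X n ω) * Set.indicator (freshEvent X n) (fun _ => (1 : ℝ)) ω
      + (1 / 2) * Set.indicator (freshEvent X n)ᶜ (fun _ => (1 : ℝ)) ω

open scoped ENNReal

/-! ### The branching mechanism -/

/-- Expectation of `V (R)`, where `R` is the sum of `L` independent fair geometric variables. -/
def fairGeom : ℕ → (ℕ → ℝ≥0∞) → ℝ≥0∞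
  | 0, V => V 0
  | L + 1, V => ∑' r : ℕ, (1 - 2⁻¹) * 2⁻¹ ^ r * fairGeom L (fun j => V (j + r))

/-- Expectation of `V (R)`, where `R` is the number of right jumps before the `L`-th left jump
from a site whose probability of a right jump is `q` until the first left jump and `1/2`
afterwards. -/
def cookieGeom (q : ℝ≥0∞) : ℕ → (ℕ → ℝ≥0∞) → ℝ≥0∞
  | 0, V => V 0
  | L + 1, V => ∑' r : ℕ, (1 - q) * q ^ r * fairGeom L (fun j => V (j + r))

lemma cookieGeom_half (L : ℕ) (V : ℕ → ℝ≥0∞) : cookieGeom 2⁻¹ L V = fairGeom L V := by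
  cases L <;> rfl

lemma fairGeom_add (L : ℕ) (V W : ℕ → ℝ≥0∞) :
    fairGeom L (fun j => V j + W j) = fairGeom L V + fairGeom L W := by
  induction L generalizing V W with
  | zero => rfl
  | succ L ih => simp only [fairGeom, ih, mul_add, ENNReal.tsum_add]

lemma fairGeom_const_mul (L : ℕ) (a : ℝ≥0∞) (V : ℕ → ℝ≥0∞) :
    fairGeom L (fun j => a * V j) = a * fairGeom L V := by
  induction L generalizing V with
  | zero => rfl
  | succ L ih => simp only [fairGeom, ih, mul_left_comm _ a, ENNReal.tsum_mul_left]

lemma cookieGeom_add (q : ℝ≥0∞) (L : ℕ) (V W : ℕ → ℝ≥0∞) :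
    cookieGeom q L (fun j => V j + W j) = cookieGeom q L V + cookieGeom q L W := by
  cases L with
  | zero => rfl
  | succ L => simp only [cookieGeom, fairGeom_add, mul_add, ENNReal.tsum_add]

lemma cookieGeom_const_mul (q : ℝ≥0∞) (L : ℕ) (a : ℝ≥0∞) (V : ℕ → ℝ≥0∞) :
    cookieGeom q L (fun j => a * V j) = a * cookieGeom q L V := by
  cases L with
  | zero => rfl
  | succ L => simp only [cookieGeom, fairGeom_const_mul, mul_left_comm _ a, ENNReal.tsum_mul_left]

lemma fairGeom_mono (L : ℕ) {V W : ℕ → ℝ≥0∞} (h : V ≤ W) : fairGeom L V ≤ fairGeom L W := by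
  induction L generalizing V W with
  | zero => exact h 0
  | succ L ih =>
    exact ENNReal.tsum_le_tsum fun r => by
      gcongr
      exact ih fun j => h (j + r)

lemma cookieGeom_mono (q : ℝ≥0∞) (L : ℕ) {V W : ℕ → ℝ≥0∞} (h : V ≤ W) :
    cookieGeom q L V ≤ cookieGeom q L W := by
  cases L with
  | zero => exact h 0
  | succ L =>
    exact ENNReal.tsum_le_tsum fun r => by
      gcongr
      exact fairGeom_mono L fun j => h (j + r)

lemma tsum_geometric_weight_le_one (q : ℝ≥0∞) : ∑' r : ℕ, (1 - q) * q ^ r ≤ 1 := by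
  rw [ENNReal.tsum_mul_left, ENNReal.tsum_geometric]
  exact ENNReal.mul_inv_le_one _

lemma tsum_geometric_weight_mul_le {q C : ℝ≥0∞} {f : ℕ → ℝ≥0∞} (h : ∀ r, f r ≤ C) :
    ∑' r : ℕ, (1 - q) * q ^ r * f r ≤ C :=
  calc ∑' r : ℕ, (1 - q) * q ^ r * f r ≤ ∑' r : ℕ, (1 - q) * q ^ r * C :=
        ENNReal.tsum_le_tsum fun r => by gcongr; exact h r
    _ = (∑' r : ℕ, (1 - q) * q ^ r) * C := ENNReal.tsum_mul_right
    _ ≤ 1 * C := by gcongr; exact tsum_geometric_weight_le_one q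
    _ = C := one_mul C

lemma fairGeom_le (L : ℕ) {V : ℕ → ℝ≥0∞} {C : ℝ≥0∞} (h : ∀ j, V j ≤ C) : fairGeom L V ≤ C := by
  induction L generalizing V with
  | zero => exact h 0
  | succ L ih => exact tsum_geometric_weight_mul_le fun r => ih fun j => h (j + r)

lemma cookieGeom_le (q : ℝ≥0∞) (L : ℕ) {V : ℕ → ℝ≥0∞} {C : ℝ≥0∞} (h : ∀ j, V j ≤ C) :
    cookieGeom q L V ≤ C := by
  cases L with
  | zero => exact h 0
  | succ L => exact tsum_geometric_weight_mul_le fun r => fairGeom_le L fun j => h (j + r)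

lemma fairGeom_succ_le (L : ℕ) {V : ℕ → ℝ≥0∞} (h : Antitone V) :
    fairGeom (L + 1) V ≤ fairGeom L V :=
  tsum_geometric_weight_mul_le fun r => fairGeom_mono L fun j => h (Nat.le_add_right j r)

lemma cookieGeom_antitone (q : ℝ≥0∞) {V : ℕ → ℝ≥0∞} (h : Antitone V) :
    Antitone (fun L => cookieGeom q L V) := by
  refine antitone_nat_of_succ_le fun L => ?_
  cases L with
  | zero => exact cookieGeom_le q 1 fun j => h (Nat.zero_le j)
  | succ L =>
    exact ENNReal.tsum_le_tsum fun r => by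
      gcongr
      exact fairGeom_succ_le L fun a b hab => h (by omega)

lemma cookieGeom_one (q : ℝ≥0∞) (V : ℕ → ℝ≥0∞) :
    cookieGeom q 1 V = ∑' r : ℕ, (1 - q) * q ^ r * V r := by
  simp [cookieGeom, fairGeom]

/-- Decomposition according to the first jump. -/
lemma cookieGeom_succ (q : ℝ≥0∞) (L : ℕ) (V : ℕ → ℝ≥0∞) :
    cookieGeom q (L + 1) V
      = q * cookieGeom q (L + 1) (fun j => V (j + 1)) + (1 - q) * fairGeom L V := by
  rw [cookieGeom, tsum_eq_zero_add' ENNReal.summable, add_comm, cookieGeom,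
    ← ENNReal.tsum_mul_left]
  congr 1
  · refine tsum_congr fun r => ?_
    rw [pow_succ]
    simp only [add_assoc]
    ring
  · simp

lemma tsum_mul_tsum_tail (c V : ℕ → ℝ≥0∞) :
    ∑' r, c r * ∑' j, V (j + r) = ∑' l, (∑ r ∈ Finset.range (l + 1), c r) * V l := by
  have h1 : ∀ r, ∑' j, V (j + r) = ∑' l, if r ≤ l then V l else 0 := by
    intro r
    rw [← ENNReal.summable.sum_add_tsum_nat_add' (k := r) (f := fun l => if r ≤ l then V l else 0)]
    rw [Finset.sum_eq_zero, zero_add]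
    · simp
    · intro i hi
      simp only [Finset.mem_range] at hi
      simp [hi]
  simp_rw [h1, ← ENNReal.tsum_mul_left]
  rw [ENNReal.tsum_comm]
  refine tsum_congr fun l => ?_
  rw [tsum_eq_sum (s := Finset.range (l + 1)), Finset.sum_mul]
  · refine Finset.sum_congr rfl fun r hr => ?_
    simp only [Finset.mem_range] at hr
    rw [if_pos (by omega)]
  · intro r hr
    simp only [Finset.mem_range] at hr
    rw [if_neg (by omega), mul_zero]

lemma geometric_weight_identity {q : ℝ≥0∞} (hq : q ≤ 1) (l : ℕ) :
    ∑ r ∈ Finset.range (l + 1), (1 - q) * q ^ r = 1 - q ^ (l + 1) := by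
  lift q to NNReal using ne_top_of_le_ne_top ENNReal.one_ne_top hq
  norm_cast at hq ⊢
  rw [← Finset.mul_sum]
  ext
  rw [NNReal.coe_mul, NNReal.coe_sub hq, NNReal.coe_sub (pow_le_one' hq _)]
  push_cast
  exact mul_neg_geom_sum (q : ℝ) (l + 1)

lemma sum_fairGeom_le (n : ℕ) (V : ℕ → ℝ≥0∞) :
    ∑ i ∈ Finset.range n, fairGeom i V ≤ V 0 + ∑' l, V l := by
  induction n generalizing V with
  | zero => simp
  | succ n ih =>
    rw [Finset.sum_range_succ', add_comm]
    refine add_le_add le_rfl ?_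
    calc ∑ i ∈ Finset.range n, fairGeom (i + 1) V
        = ∑' r : ℕ, (1 - 2⁻¹) * 2⁻¹ ^ r * ∑ i ∈ Finset.range n, fairGeom i (fun j => V (j + r)) := by
          simp only [fairGeom, Finset.mul_sum]
          rw [Summable.tsum_finsetSum fun _ _ => ENNReal.summable]
      _ ≤ ∑' r : ℕ, (1 - 2⁻¹) * 2⁻¹ ^ r * (V (0 + r) + ∑' l, V (l + r)) :=
          ENNReal.tsum_le_tsum fun r => by gcongr; exact ih _
      _ = ∑' l, ((1 - 2⁻¹) * 2⁻¹ ^ l * V l + (1 - 2⁻¹ ^ (l + 1)) * V l) := by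
          simp only [mul_add, ENNReal.tsum_add, zero_add]
          rw [tsum_mul_tsum_tail]
          simp only [geometric_weight_identity (q := 2⁻¹) (by simp)]
      _ = ∑' l, V l := by
          refine tsum_congr fun l => ?_
          have : (1 - 2⁻¹ : ℝ≥0∞) * 2⁻¹ ^ l = 2⁻¹ ^ (l + 1) := by
            rw [ENNReal.one_sub_inv_two, pow_succ, mul_comm]
          rw [this, ← add_mul, add_tsub_cancel_of_le (pow_le_one' (by simp) _), one_mul]

/-- The expected-drift inequality for one generation of the branching process. -/
lemma tsum_cookieGeom_add_le {q : ℝ≥0∞} (hq1 : 2⁻¹ ≤ q) (hq : q ≤ 1) (V : ℕ → ℝ≥0∞) :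
    ∑' i, cookieGeom q (i + 1) V + (2 * q - 1) * ∑' l, q ^ l * V l ≤ ∑' l, V l := by
  have h1 : ∑' i, cookieGeom q (i + 1) V
      ≤ ∑' r, (1 - q) * q ^ r * (V r + ∑' l, V (l + r)) := by
    simp only [cookieGeom]
    rw [ENNReal.tsum_comm]
    refine ENNReal.tsum_le_tsum fun r => ?_
    rw [ENNReal.tsum_mul_left]
    gcongr
    rw [ENNReal.tsum_eq_iSup_nat]
    refine iSup_le fun n => (sum_fairGeom_le n _).trans (by simp)
  calc _ ≤ ∑' r, (1 - q) * q ^ r * (V r + ∑' l, V (l + r))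
        + (2 * q - 1) * ∑' l, q ^ l * V l := by gcongr
    _ = ∑' l, ((1 - q) * q ^ l * V l + (1 - q ^ (l + 1)) * V l
          + (2 * q - 1) * (q ^ l * V l)) := by
        simp only [mul_add, ENNReal.tsum_add, ENNReal.tsum_mul_left]
        rw [tsum_mul_tsum_tail]
        simp only [geometric_weight_identity hq]
    _ = ∑' l, V l := by
        refine tsum_congr fun l => ?_
        rw [← mul_assoc, ← add_mul, ← add_mul]
        have : (1 - q) * q ^ l + (1 - q ^ (l + 1)) + (2 * q - 1) * q ^ l = 1 := by
          lift q to NNReal using ne_top_of_le_ne_top ENNReal.one_ne_top hq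
          have h2 : (1 : NNReal) ≤ 2 * q := by
            have h3 : (1 : ℝ≥0∞) ≤ 2 * q := by
              calc (1 : ℝ≥0∞) = 2 * 2⁻¹ := (ENNReal.mul_inv_cancel (by simp) (by simp)).symm
                _ ≤ _ := by gcongr
            exact_mod_cast h3
          norm_cast at hq ⊢
          ext
          push_cast [NNReal.coe_sub hq, NNReal.coe_sub (pow_le_one' hq (l + 1)), NNReal.coe_sub h2]
          ring
        rw [this, one_mul]

/-! ### Probability of coming back below a site -/

/-- Probability that the walk in the environment `e`, standing at `y`, comes back to `z - 1`
before reaching `z + m`, when it has to make `L` additional excursions from `z - 1`. -/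
def returnProb (e : ℤ → ℝ) (y : ℤ) : ℕ → ℤ → ℕ → ℝ≥0∞
  | 0, z, L => if L + (if z ≤ y then 1 else 0) = 0 then 1 else 0
  | m + 1, z, L =>
    cookieGeom (ENNReal.ofReal (e z)) (L + if z ≤ y then 1 else 0) (returnProb e y m (z + 1))

lemma returnProb_le_one (e : ℤ → ℝ) (y : ℤ) (m : ℕ) (z : ℤ) (L : ℕ) :
    returnProb e y m z L ≤ 1 := by
  induction m generalizing z L with
  | zero => rw [returnProb]; split_ifs <;> simp
  | succ m ih => exact cookieGeom_le _ _ fun j => ih _ _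

lemma returnProb_eq_one (e : ℤ → ℝ) {y z : ℤ} (h : y < z) (m : ℕ) :
    returnProb e y m z 0 = 1 := by
  induction m generalizing z with
  | zero => simp [returnProb, h]
  | succ m ih =>
    rw [returnProb, if_neg (by omega)]
    exact ih (by omega)

lemma returnProb_antitone (e : ℤ → ℝ) (y : ℤ) (m : ℕ) (z : ℤ) :
    Antitone (returnProb e y m z) := by
  induction m generalizing z with
  | zero =>
    intro L L' h
    simp only [returnProb]
    split_ifs <;> first | omega | simp
  | succ m ih =>
    intro L L' h
    exact cookieGeom_antitone _ (ih _) (by omega)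

lemma returnProb_mono_fuel (e : ℤ → ℝ) (y z : ℤ) (L : ℕ) :
    Monotone (fun m => returnProb e y m z L) := by
  refine monotone_nat_of_le_succ fun m => ?_
  induction m generalizing z L with
  | zero =>
    by_cases hL : L + (if z ≤ y then 1 else 0) = 0
    · have hz : y < z := by
        by_contra hz
        rw [if_pos (by omega)] at hL
        omega
      obtain rfl : L = 0 := by omega
      rw [returnProb_eq_one e hz, returnProb_eq_one e hz]
    · rw [returnProb, if_neg hL]
      exact zero_le
  | succ m ih => exact cookieGeom_mono _ _ fun j => ih _ _

lemma returnProb_congr {e e' : ℤ → ℝ} {y y' : ℤ} (m : ℕ) {z : ℤ} (L : ℕ)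
    (he : ∀ w, z ≤ w → e w = e' w) (hy : ∀ w, z ≤ w → (w ≤ y ↔ w ≤ y')) :
    returnProb e y m z L = returnProb e' y' m z L := by
  induction m generalizing z L with
  | zero => simp only [returnProb, hy z le_rfl]
  | succ m ih =>
    simp only [returnProb, hy z le_rfl, he z le_rfl]
    congr 1
    funext j
    exact ih j (fun w hw => he w (by omega)) (fun w hw => hy w (by omega))

lemma returnProb_shift (e : ℤ → ℝ) (y s : ℤ) (m : ℕ) (z : ℤ) (L : ℕ) :
    returnProb (fun x => e (x + s)) y m z L = returnProb e (y + s) m (z + s) L := by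
  induction m generalizing z L with
  | zero => simp [returnProb]
  | succ m ih =>
    simp only [returnProb, add_le_add_iff_right]
    congr 1
    funext j
    rw [ih]
    congr 1
    ring

lemma returnProb_self (e : ℤ → ℝ) (y : ℤ) (m : ℕ) (L : ℕ) :
    returnProb e y m y L = returnProb e (y - 1) m y (L + 1) := by
  cases m with
  | zero => simp [returnProb]
  | succ m =>
    have : returnProb e y m (y + 1) = returnProb e (y - 1) m (y + 1) := by
      funext j
      exact returnProb_congr m j (fun _ _ => rfl) (fun w hw => by omega)
    simp [returnProb, this]

lemma returnProb_step (e : ℤ → ℝ) (y : ℤ) (m : ℕ) (z : ℤ) (L : ℕ) (h1 : z ≤ y) (h2 : y < z + m) :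
    returnProb e y m z L = ENNReal.ofReal (e y) * returnProb e (y + 1) m z L
      + (1 - ENNReal.ofReal (e y)) *
        returnProb (Function.update e y (1 / 2)) (y - 1) m z L := by
  induction m generalizing z L with
  | zero => push_cast at h2; omega
  | succ m ih =>
    rcases h1.eq_or_lt with rfl | h1
    · have hA : returnProb e (z + 1) m (z + 1) = fun j => returnProb e z m (z + 1) (j + 1) := by
        funext j
        rw [returnProb_self]
        simp
      have hB : returnProb (Function.update e z (1 / 2)) (z - 1) m (z + 1)
          = returnProb e z m (z + 1) := by
        funext j
        refine returnProb_congr m j (fun w hw => ?_) (fun w hw => by omega)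
        rw [Function.update_of_ne (by omega)]
      have hhalf : ENNReal.ofReal (1 / 2) = 2⁻¹ := by
        rw [one_div, ENNReal.ofReal_inv_of_pos (by norm_num)]; simp
      simp only [returnProb, hA, hB, Function.update_self, hhalf]
      rw [if_pos le_rfl, if_pos (by omega), if_neg (by omega), add_zero, cookieGeom_half]
      exact cookieGeom_succ _ L _
    · simp only [returnProb]
      rw [if_pos (by omega), if_pos (by omega), if_pos (by omega),
        Function.update_of_ne (by omega), ← cookieGeom_const_mul, ← cookieGeom_const_mul,
        ← cookieGeom_add]
      congr 1
      funext j
      exact ih (z + 1) j (by omega) (by push_cast at h2; omega)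

/-- Probability that the walk in the environment `e`, standing at `y`, ever reaches `b`. -/
def hitProb (e : ℤ → ℝ) (b y : ℤ) : ℝ≥0∞ := ⨆ m, returnProb e y m (b + 1) 0

lemma hitProb_le_one (e : ℤ → ℝ) (b y : ℤ) : hitProb e b y ≤ 1 :=
  iSup_le fun _ => returnProb_le_one _ _ _ _ _

lemma hitProb_eq_one (e : ℤ → ℝ) {b y : ℤ} (h : y ≤ b) : hitProb e b y = 1 := by
  simp only [hitProb, returnProb_eq_one e (show y < b + 1 by omega), ciSup_const]

lemma hitProb_step (e : ℤ → ℝ) {b y : ℤ} (h : b < y) :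
    hitProb e b y = ENNReal.ofReal (e y) * hitProb e b (y + 1)
      + (1 - ENNReal.ofReal (e y)) * hitProb (Function.update e y (1 / 2)) b (y - 1) := by
  have key : ∀ e y, hitProb e b y = ⨆ m, returnProb e y (m + (y - b).toNat) (b + 1) 0 :=
    fun e y => ((returnProb_mono_fuel e y (b + 1) 0).iSup_nat_add _).symm
  have key' : ∀ e y', hitProb e b y' = ⨆ m, returnProb e y' (m + (y - b).toNat) (b + 1) 0 :=
    fun e y' => ((returnProb_mono_fuel e y' (b + 1) 0).iSup_nat_add _).symm
  rw [key', key', key', ENNReal.mul_iSup, ENNReal.mul_iSup, ENNReal.iSup_add_iSup_of_monotone]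
  · refine iSup_congr fun m => returnProb_step e y _ _ _ (by omega) (by push_cast; omega)
  · exact fun m m' hm => mul_le_mul_right (returnProb_mono_fuel _ _ _ _ (by omega)) _
  · exact fun m m' hm => mul_le_mul_right (returnProb_mono_fuel _ _ _ _ (by omega)) _

lemma returnProb_succ_le (e : ℤ → ℝ) (y : ℤ) (m : ℕ) (z : ℤ) (L : ℕ) :
    returnProb e y (m + 1) z L ≤ returnProb e y m (z + 1) 0 :=
  cookieGeom_le _ _ fun j => returnProb_antitone e y m (z + 1) (Nat.zero_le j)

lemma hitProb_mono_left (e : ℤ → ℝ) (y : ℤ) : Monotone (fun b => hitProb e b y) := by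
  refine monotone_int_of_le_succ fun b => ?_
  refine iSup_le fun m => le_iSup_of_le m ?_
  exact (returnProb_mono_fuel e y (b + 1) 0 (Nat.le_succ m)).trans (returnProb_succ_le e y m _ 0)

/-- Probability of extinction before generation `m` of the branching process in the
environment `e` started from `L` individuals. -/
def extProb (m : ℕ) (e : ℤ → ℝ) (L : ℕ) : ℝ≥0∞ := returnProb e (-1) m 0 L

lemma hitProb_pred (e : ℤ → ℝ) (y : ℤ) :
    hitProb e (y - 1) y = ⨆ m, extProb m (fun x => e (x + y)) 1 := by
  refine iSup_congr fun m => ?_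
  rw [extProb, returnProb_shift, sub_add_cancel, returnProb_self]
  congr 1 <;> ring

lemma extProb_zero (e : ℤ → ℝ) (L : ℕ) : extProb 0 e L = if L = 0 then 1 else 0 := by
  simp [extProb, returnProb]

lemma extProb_succ (m : ℕ) (e : ℤ → ℝ) (L : ℕ) :
    extProb (m + 1) e L
      = cookieGeom (ENNReal.ofReal (e 0)) L (extProb m (fun x => e (x + 1))) := by
  rw [extProb, returnProb, if_neg (by omega), add_zero]
  congr 1
  funext j
  rw [extProb, returnProb_shift]
  exact returnProb_congr m j (fun _ _ => rfl) (fun w hw => by omega)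

lemma extProb_mono (e : ℤ → ℝ) (L : ℕ) : Monotone (fun m => extProb m e L) :=
  returnProb_mono_fuel _ _ _ _

lemma extProb_le_one (m : ℕ) (e : ℤ → ℝ) (L : ℕ) : extProb m e L ≤ 1 :=
  returnProb_le_one _ _ _ _ _

lemma measurable_fairGeom {α : Type*} [MeasurableSpace α] (L : ℕ) {V : α → ℕ → ℝ≥0∞}
    (hV : ∀ r, Measurable fun a => V a r) : Measurable fun a => fairGeom L (V a) := by
  induction L generalizing V with
  | zero => exact hV 0
  | succ L ih => exact Measurable.tsum fun r => (ih fun j => hV _).const_mul _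

lemma measurable_cookieGeom {α : Type*} [MeasurableSpace α] (L : ℕ) {V : α → ℕ → ℝ≥0∞}
    {q : α → ℝ≥0∞} (hq : Measurable q) (hV : ∀ r, Measurable fun a => V a r) :
    Measurable fun a => cookieGeom (q a) L (V a) := by
  cases L with
  | zero => exact hV 0
  | succ L =>
    exact Measurable.tsum fun r =>
      ((measurable_const.sub hq).mul (hq.pow_const r)).mul (measurable_fairGeom L fun j => hV _)

lemma measurable_returnProb (y : ℤ) (m : ℕ) (z : ℤ) (L : ℕ) :
    Measurable fun e : ℤ → ℝ => returnProb e y m z L := by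
  induction m generalizing z L with
  | zero => exact measurable_const
  | succ m ih =>
    exact measurable_cookieGeom _ (ENNReal.measurable_ofReal.comp (measurable_pi_apply z))
      fun r => ih _ _

lemma measurable_hitProb (b : ℤ) : Measurable fun p : (ℤ → ℝ) × ℤ => hitProb p.1 b p.2 :=
  measurable_from_prod_countable_left fun y =>
    Measurable.iSup fun m => measurable_returnProb y m (b + 1) 0

lemma measurable_extProb (m L : ℕ) : Measurable fun e : ℤ → ℝ => extProb m e L :=
  measurable_returnProb _ _ _ _

/-! ### Survival in an ergodic environment -/

/-- Probability of eventual extinction of the branching process in the environment `e` started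
from one individual. -/
def extLim (e : ℤ → ℝ) : ℝ≥0∞ := ⨆ m, extProb m e 1

lemma extLim_le_one (e : ℤ → ℝ) : extLim e ≤ 1 := iSup_le fun _ => extProb_le_one _ _ _

lemma measurable_extLim : Measurable extLim := Measurable.iSup fun m => measurable_extProb m 1

lemma hitProb_pred_eq_extLim (e : ℤ → ℝ) (y : ℤ) :
    hitProb e (y - 1) y = extLim (fun x => e (x + y)) := hitProb_pred e y

lemma extProb_zero_right (m : ℕ) (e : ℤ → ℝ) : extProb m e 0 = 1 :=
  returnProb_eq_one e (by norm_num) m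

lemma inv_two_le_ofReal {t : ℝ} (h : 1 / 2 ≤ t) : (2⁻¹ : ℝ≥0∞) ≤ ENNReal.ofReal t := by
  have := ENNReal.ofReal_le_ofReal h
  rwa [one_div, ENNReal.ofReal_inv_of_pos (by norm_num), ENNReal.ofReal_ofNat] at this

lemma iSup_extProb_shift_eq_one {e : ℤ → ℝ} (he : e 0 ∈ Set.Ico (1 / 2 : ℝ) 1)
    (h : extLim e = 1) (r : ℕ) : ⨆ m, extProb m (fun x => e (x + 1)) r = 1 := by
  set q := ENNReal.ofReal (e 0) with hq
  set S : ℕ → ℝ≥0∞ := fun r => ⨆ m, extProb m (fun x => e (x + 1)) r with hS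
  have hS1 : ∀ r, S r ≤ 1 := fun r => iSup_le fun _ => extProb_le_one _ _ _
  have hle : extLim e ≤ ∑' r : ℕ, (1 - q) * q ^ r * S r := by
    refine iSup_le fun m => ?_
    cases m with
    | zero => simp [extProb_zero]
    | succ m =>
      rw [extProb_succ, cookieGeom_one]
      exact ENNReal.tsum_le_tsum fun r => by
        gcongr
        exact le_iSup (fun m => extProb m (fun x => e (x + 1)) r) m
  by_contra hne
  have hlt : S r < 1 := lt_of_le_of_ne (hS1 r) hne
  have hq1 : q < 1 := by
    rw [hq, ENNReal.ofReal_lt_one]; exact he.2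
  have hq0 : q ≠ 0 := by
    rw [hq]
    exact (ENNReal.ofReal_pos.2 (by linarith [he.1])).ne'
  have hw0 : (1 - q) * q ^ r ≠ 0 := mul_ne_zero (tsub_pos_of_lt hq1).ne' (pow_ne_zero _ hq0)
  have hwt : (1 - q) * q ^ r ≠ ∞ :=
    ENNReal.mul_ne_top (by simp) (ENNReal.pow_ne_top ENNReal.ofReal_ne_top)
  have hfin : ∑' r : ℕ, (1 - q) * q ^ r * S r ≤ 1 := tsum_geometric_weight_mul_le hS1
  have : ∑' r : ℕ, (1 - q) * q ^ r * S r < ∑' r : ℕ, (1 - q) * q ^ r * 1 := by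
    refine ENNReal.tsum_lt_tsum (i := r) (ne_top_of_le_ne_top ENNReal.one_ne_top hfin)
      (fun r => by gcongr; exact hS1 r) ?_
    exact ENNReal.mul_lt_mul_right hw0 hwt hlt
  have h2 : ∑' r : ℕ, (1 - q) * q ^ r * 1 ≤ 1 := tsum_geometric_weight_mul_le fun _ => le_rfl
  exact absurd h (hle.trans_lt (this.trans_le h2)).ne

/-- Expected drift collected at the origin before generation `m` becomes extinct. -/
def driftBefore (m : ℕ) (e : ℤ → ℝ) : ℝ≥0∞ :=
  (2 * ENNReal.ofReal (e 0) - 1)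
    * ∑' l, ENNReal.ofReal (e 0) ^ l * extProb m (fun x => e (x + 1)) l

lemma driftBefore_mono (e : ℤ → ℝ) : Monotone fun m => driftBefore m e := fun m m' h => by
  unfold driftBefore
  exact mul_le_mul_right (ENNReal.tsum_le_tsum fun l => mul_le_mul_right (extProb_mono _ _ h) _) _

lemma measurable_shift : Measurable fun (e : ℤ → ℝ) (x : ℤ) => e (x + 1) :=
  measurable_pi_lambda _ fun _ => measurable_pi_apply _

lemma measurable_driftBefore (m : ℕ) : Measurable (driftBefore m) := by
  have h0 : Measurable fun e : ℤ → ℝ => ENNReal.ofReal (e 0) :=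
    ENNReal.measurable_ofReal.comp (measurable_pi_apply 0)
  exact ((h0.const_mul 2).sub measurable_const).mul
    (Measurable.tsum fun l => (h0.pow_const l).mul ((measurable_extProb m l).comp measurable_shift))

lemma tsum_extProb_succ_add_le (m : ℕ) {e : ℤ → ℝ} (he : e 0 ∈ Set.Ico (1 / 2 : ℝ) 1) :
    ∑' L, extProb (m + 1) e L + driftBefore m e
      ≤ 1 + ∑' L, extProb m (fun x => e (x + 1)) L := by
  rw [tsum_eq_zero_add' ENNReal.summable, extProb_zero_right, add_assoc]
  refine add_le_add le_rfl ?_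
  simp only [extProb_succ]
  exact tsum_cookieGeom_add_le (inv_two_le_ofReal he.1)
    (ENNReal.ofReal_le_one.2 he.2.le) _

lemma iSup_driftBefore {e : ℤ → ℝ} (he : e 0 ∈ Set.Ico (1 / 2 : ℝ) 1)
    (h : ∀ r, ⨆ m, extProb m (fun x => e (x + 1)) r = 1) :
    ENNReal.ofReal (e 0 / (1 - e 0)) ≤ (⨆ m, driftBefore m e) + 1 := by
  unfold driftBefore
  rw [← ENNReal.mul_iSup]
  set q := ENNReal.ofReal (e 0) with hq
  have h1 : ∑' l, q ^ l ≤ ⨆ m, ∑' l, q ^ l * extProb m (fun x => e (x + 1)) l := by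
    rw [ENNReal.tsum_eq_iSup_nat]
    refine iSup_le fun n => ?_
    calc ∑ l ∈ Finset.range n, q ^ l
        = ∑ l ∈ Finset.range n, ⨆ m, q ^ l * extProb m (fun x => e (x + 1)) l := by
          simp only [← ENNReal.mul_iSup, h, mul_one]
      _ = ⨆ m, ∑ l ∈ Finset.range n, q ^ l * extProb m (fun x => e (x + 1)) l :=
          ENNReal.finsetSum_iSup_of_monotone fun l m m' hm =>
            mul_le_mul_right (extProb_mono _ _ hm) _
      _ ≤ _ := iSup_mono fun m => ENNReal.sum_le_tsum _
  refine le_trans ?_ (add_le_add (mul_le_mul_right h1 _) le_rfl)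
  rw [ENNReal.tsum_geometric]
  have h0 : 0 < 1 - e 0 := by linarith [he.2]
  have e1 : (1 - q)⁻¹ = ENNReal.ofReal (1 - e 0)⁻¹ := by
    rw [ENNReal.ofReal_inv_of_pos h0, ENNReal.ofReal_sub _ (by linarith [he.1]),
      ENNReal.ofReal_one]
  have e2 : 2 * q - 1 = ENNReal.ofReal (2 * e 0 - 1) := by
    rw [ENNReal.ofReal_sub _ zero_le_one, ENNReal.ofReal_mul (by norm_num), ENNReal.ofReal_one,
      ENNReal.ofReal_ofNat]
  rw [e1, e2, ← ENNReal.ofReal_mul (by linarith [he.1]), ← ENNReal.ofReal_one,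
    ← ENNReal.ofReal_add (mul_nonneg (by linarith [he.1]) (by positivity)) zero_le_one]
  refine ENNReal.ofReal_le_ofReal (le_of_eq ?_)
  field_simp
  ring

lemma sum_lintegral_driftBefore_le {μ : Measure (ℤ → ℝ)} [IsProbabilityMeasure μ]
    (hθ : MeasurePreserving (fun (e : ℤ → ℝ) (x : ℤ) => e (x + 1)) μ μ)
    (hrange : ∀ᵐ e ∂μ, ∀ x, e x ∈ Set.Ico (1 / 2 : ℝ) 1) (k : ℕ) :
    ∫⁻ e, ∑' L, extProb k e L ∂μ + ∑ j ∈ Finset.range k, ∫⁻ e, driftBefore j e ∂μ ≤ k + 1 := by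
  have hmeas : ∀ m, Measurable fun e : ℤ → ℝ => ∑' L, extProb m e L :=
    fun m => Measurable.tsum fun L => measurable_extProb m L
  induction k with
  | zero => simp [extProb_zero]
  | succ k ih =>
    rw [Finset.sum_range_succ, add_comm (∑ j ∈ Finset.range k, _), ← add_assoc,
      ← lintegral_add_left (hmeas _)]
    calc _ ≤ ∫⁻ e, (1 + ∑' L, extProb k (fun x => e (x + 1)) L) ∂μ
            + ∑ j ∈ Finset.range k, ∫⁻ e, driftBefore j e ∂μ := by
          gcongr ?_ + _
          exact lintegral_mono_ae (hrange.mono fun e he => tsum_extProb_succ_add_le k (he 0))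
      _ = 1 + (∫⁻ e, ∑' L, extProb k e L ∂μ
            + ∑ j ∈ Finset.range k, ∫⁻ e, driftBefore j e ∂μ) := by
          rw [lintegral_add_left measurable_const, hθ.lintegral_comp (hmeas k)]
          simp [add_assoc]
      _ ≤ 1 + (k + 1) := by gcongr
      _ = _ := by push_cast; ring

lemma lintegral_driftBefore_le_one {μ : Measure (ℤ → ℝ)} [IsProbabilityMeasure μ]
    (hθ : MeasurePreserving (fun (e : ℤ → ℝ) (x : ℤ) => e (x + 1)) μ μ)
    (hrange : ∀ᵐ e ∂μ, ∀ x, e x ∈ Set.Ico (1 / 2 : ℝ) 1) (m : ℕ) :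
    ∫⁻ e, driftBefore m e ∂μ ≤ 1 := by
  by_contra! hlt
  obtain ⟨c, hc1, hc⟩ := ENNReal.lt_iff_exists_nnreal_btwn.1 hlt
  have key : ∀ n : ℕ, (n : ℝ) * c ≤ n + m + 1 := by
    intro n
    have h1 : (n : ℝ≥0∞) * c ≤ n + m + 1 :=
      calc (n : ℝ≥0∞) * c = ∑ j ∈ Finset.range n, (c : ℝ≥0∞) := by simp
        _ ≤ ∑ j ∈ Finset.range n, ∫⁻ e, driftBefore (m + j) e ∂μ :=
            Finset.sum_le_sum fun j _ => hc.le.trans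
              (lintegral_mono fun e => driftBefore_mono e (Nat.le_add_right m j))
        _ ≤ ∑ j ∈ Finset.range (m + n), ∫⁻ e, driftBefore j e ∂μ := by
            rw [Finset.sum_range_add]
            exact le_add_self
        _ ≤ ((m + n : ℕ) : ℝ≥0∞) + 1 :=
            le_trans le_add_self (sum_lintegral_driftBefore_le hθ hrange (m + n))
        _ = n + m + 1 := by push_cast; ring
    exact_mod_cast h1
  have hc1' : (1 : ℝ) < c := by exact_mod_cast hc1
  obtain ⟨n, hn⟩ := exists_nat_gt ((m + 1 : ℝ) / (c - 1))
  rw [div_lt_iff₀ (by linarith)] at hn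
  linarith [key n]

/-- In an ergodic environment with mean total drift per site larger than one, the branching
process survives with positive probability. -/
lemma ae_extLim_lt_one {μ : Measure (ℤ → ℝ)} [IsProbabilityMeasure μ]
    (herg : Ergodic (fun (e : ℤ → ℝ) (x : ℤ) => e (x + 1)) μ)
    (hrange : ∀ᵐ e ∂μ, ∀ x, e x ∈ Set.Ico (1 / 2 : ℝ) 1)
    (hexp : 2 < ∫⁻ e, ENNReal.ofReal (e 0 / (1 - e 0)) ∂μ) :
    ∀ᵐ e ∂μ, extLim e < 1 := by
  have hS : MeasurableSet {e : ℤ → ℝ | extLim e = 1} :=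
    measurable_extLim (measurableSet_singleton 1)
  have hinv : {e : ℤ → ℝ | extLim e = 1}
      ≤ᵐ[μ] (fun (e : ℤ → ℝ) (x : ℤ) => e (x + 1)) ⁻¹' {e : ℤ → ℝ | extLim e = 1} :=
    hrange.mono fun e he h => iSup_extProb_shift_eq_one (he 0) h 1
  rcases herg.ae_empty_or_univ_of_ae_le_preimage hS.nullMeasurableSet hinv with h | h
  · filter_upwards [ae_eq_empty.1 h |> measure_eq_zero_iff_ae_notMem.1] with e he
    exact lt_of_le_of_ne (extLim_le_one e) he
  · exfalso
    refine hexp.not_ge ?_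
    have h1 : ∀ᵐ e ∂μ, extLim e = 1 := eventuallyEq_univ.1 h
    calc ∫⁻ e, ENNReal.ofReal (e 0 / (1 - e 0)) ∂μ
        ≤ ∫⁻ e, ((⨆ m, driftBefore m e) + 1) ∂μ := by
          refine lintegral_mono_ae ?_
          filter_upwards [hrange, h1] with e he h1e
          exact iSup_driftBefore (he 0) (iSup_extProb_shift_eq_one (he 0) h1e)
      _ = (⨆ m, ∫⁻ e, driftBefore m e ∂μ) + 1 := by
          rw [lintegral_add_right _ measurable_const,
            lintegral_iSup measurable_driftBefore fun m m' hm e => driftBefore_mono e hm]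
          simp
      _ ≤ 1 + 1 := by
          gcongr
          exact iSup_le fun m => lintegral_driftBefore_le_one herg.toMeasurePreserving hrange m
      _ = 2 := one_add_one_eq_two

lemma iterate_shift (n : ℕ) (e : ℤ → ℝ) :
    (fun (e : ℤ → ℝ) (x : ℤ) => e (x + 1))^[n] e = fun x => e (x + n) := by
  induction n generalizing e with
  | zero => simp
  | succ n ih =>
    rw [Function.iterate_succ_apply, ih]
    funext x
    push_cast
    congr 1
    ring

/-- By Poincaré recurrence, the survival probability is bounded below along a random
subsequence of sites. -/
lemma ae_exists_frequently_extLim_le {μ : Measure (ℤ → ℝ)} [IsProbabilityMeasure μ]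
    (hθ : MeasurePreserving (fun (e : ℤ → ℝ) (x : ℤ) => e (x + 1)) μ μ)
    (h : ∀ᵐ e ∂μ, extLim e < 1) :
    ∀ᵐ e ∂μ, ∃ c < 1, ∃ᶠ n : ℕ in atTop, extLim (fun x => e (x + n)) ≤ c := by
  have hrec : ∀ᵐ e ∂μ, ∀ k : ℕ, e ∈ {e | extLim e ≤ 1 - (k + 1 : ℝ≥0∞)⁻¹} →
      ∃ᶠ n in atTop, (fun (e : ℤ → ℝ) (x : ℤ) => e (x + 1))^[n] e
        ∈ {e | extLim e ≤ 1 - (k + 1 : ℝ≥0∞)⁻¹} :=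
    ae_all_iff.2 fun k => hθ.conservative.ae_mem_imp_frequently_image_mem
      (measurable_extLim measurableSet_Iic).nullMeasurableSet
  filter_upwards [h, hrec] with e he hr
  obtain ⟨k, hk⟩ := ENNReal.exists_inv_nat_lt (tsub_pos_of_lt he).ne'
  refine ⟨1 - (k + 1 : ℝ≥0∞)⁻¹, ENNReal.sub_lt_self (by simp) (by simp) (by simp), ?_⟩
  have hmem : extLim e ≤ 1 - (k + 1 : ℝ≥0∞)⁻¹ := by
    have : (k + 1 : ℝ≥0∞)⁻¹ ≤ 1 - extLim e :=
      (ENNReal.inv_le_inv.2 le_self_add).trans hk.le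
    exact ENNReal.le_sub_of_add_le_left (by simp) (by
      rw [add_comm]
      exact (add_le_add le_rfl this).trans (add_tsub_cancel_of_le he.le).le)
  simpa only [Set.mem_ofPred_eq, iterate_shift] using hr k hmem

/-! ### The walk -/

open scoped Classical in
/-- The environment seen by the walk at time `n`: the cookie environment `η`, except at the sites
from which the walk has already jumped to the left, where the walk has become symmetric. -/
def currentEnv {Ω : Type*} (η : Ω → ℤ → ℝ) (X : ℕ → Ω → ℤ) (n : ℕ) (ω : Ω) (z : ℤ) : ℝ :=
  if ∃ m < n, X m ω = z ∧ X (m + 1) ω = z - 1 then 1 / 2 else η ω z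

lemma currentEnv_zero {Ω : Type*} (η : Ω → ℤ → ℝ) (X : ℕ → Ω → ℤ) (ω : Ω) :
    currentEnv η X 0 ω = η ω := by
  funext z
  simp [currentEnv]

lemma currentEnv_succ_of_right {Ω : Type*} (η : Ω → ℤ → ℝ) (X : ℕ → Ω → ℤ) {n : ℕ} {ω : Ω}
    (h : X (n + 1) ω = X n ω + 1) : currentEnv η X (n + 1) ω = currentEnv η X n ω := by
  funext z
  unfold currentEnv
  congr 1
  refine propext ⟨fun ⟨m, hm, hz⟩ => ⟨m, ?_, hz⟩, fun ⟨m, hm, hz⟩ => ⟨m, by omega, hz⟩⟩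
  rcases (Nat.lt_succ_iff.1 hm).eq_or_lt with rfl | hm
  · omega
  · exact hm

lemma currentEnv_succ_of_left {Ω : Type*} (η : Ω → ℤ → ℝ) (X : ℕ → Ω → ℤ) {n : ℕ} {ω : Ω}
    (h : X (n + 1) ω = X n ω - 1) :
    currentEnv η X (n + 1) ω = Function.update (currentEnv η X n ω) (X n ω) (1 / 2) := by
  funext z
  by_cases hz : z = X n ω
  · subst hz
    rw [Function.update_self, currentEnv, if_pos ⟨n, by omega, rfl, h⟩]
  · rw [Function.update_of_ne hz]
    unfold currentEnv
    congr 1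
    refine propext ⟨fun ⟨m, hm, hz'⟩ => ⟨m, ?_, hz'⟩, fun ⟨m, hm, hz'⟩ => ⟨m, by omega, hz'⟩⟩
    rcases (Nat.lt_succ_iff.1 hm).eq_or_lt with rfl | hm
    · exact absurd hz'.1.symm hz
    · exact hm

lemma currentEnv_mem {Ω : Type*} {η : Ω → ℤ → ℝ} (X : ℕ → Ω → ℤ) (n : ℕ) {ω : Ω}
    (h : ∀ x, η ω x ∈ Set.Ico (1 / 2 : ℝ) 1) (z : ℤ) :
    currentEnv η X n ω z ∈ Set.Ico (1 / 2 : ℝ) 1 := by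
  unfold currentEnv
  split_ifs
  · norm_num
  · exact h z

lemma currentEnv_self {Ω : Type*} (η : Ω → ℤ → ℝ) (X : ℕ → Ω → ℤ) (n : ℕ) (ω : Ω) :
    η ω (X n ω) * Set.indicator (freshEvent X n) (fun _ => (1 : ℝ)) ω
      + (1 / 2) * Set.indicator (freshEvent X n)ᶜ (fun _ => (1 : ℝ)) ω
      = currentEnv η X n ω (X n ω) := by
  by_cases hω : ω ∈ freshEvent X n
  · have : ¬∃ m < n, X m ω = X n ω ∧ X (m + 1) ω = X n ω - 1 := by
      rintro ⟨m, hm, h1, h2⟩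
      exact hω m hm ⟨h1, by omega⟩
    rw [currentEnv, if_neg this]
    simp [hω]
  · have : ∃ m < n, X m ω = X n ω ∧ X (m + 1) ω = X n ω - 1 := by
      simp only [freshEvent, Set.mem_ofPred_eq, not_forall, not_not] at hω
      obtain ⟨m, hm, h1, h2⟩ := hω
      exact ⟨m, hm, h1, by omega⟩
    rw [currentEnv, if_pos this]
    simp [hω]

namespace IsCookieRWRE

variable {Ω : Type*} {mΩ : MeasurableSpace Ω} {P : Measure Ω} {η : Ω → ℤ → ℝ} {X : ℕ → Ω → ℤ}

/-- The filtration generated by the environment and the walk. -/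
def filtration (h : IsCookieRWRE P η X) : Filtration ℕ mΩ where
  seq n := MeasurableSpace.comap η inferInstance ⊔ natSA X n
  mono' m n hmn := sup_le_sup_left
    (biSup_mono fun i hi => by simp only [Finset.mem_range] at hi ⊢; omega) _
  le' n := sup_le h.envMeas.comap_le (iSup₂_le fun m _ => (h.meas m).comap_le)

lemma measurable_env (h : IsCookieRWRE P η X) (n : ℕ) : Measurable[h.filtration n] η :=
  (comap_measurable η).mono le_sup_left le_rfl

lemma measurable_walk (h : IsCookieRWRE P η X) {m n : ℕ} (hmn : m ≤ n) :
    Measurable[h.filtration n] (X m) :=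
  (comap_measurable (X m)).mono
    (le_sup_of_le_right (le_iSup₂_of_le (f := fun m (_ : m ∈ Finset.range (n + 1)) =>
      MeasurableSpace.comap (X m) ⊤) m (by simp; omega) le_rfl)) le_rfl

lemma measurable_currentEnv (h : IsCookieRWRE P η X) (n : ℕ) :
    Measurable[h.filtration n] (currentEnv η X n) := by
  refine @measurable_pi_lambda _ _ _ (h.filtration n) _ _ fun z => ?_
  suffices hs : MeasurableSet[h.filtration n] {ω | ∃ m < n, X m ω = z ∧ X (m + 1) ω = z - 1} by
    classical
    have hc : Measurable[h.filtration n] fun _ : Ω => (1 / 2 : ℝ) := measurable_const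
    have hz : Measurable[h.filtration n] fun ω => η ω z :=
      (measurable_pi_apply z).comp (h.measurable_env n)
    exact Measurable.ite hs hc hz
  have : {ω | ∃ m < n, X m ω = z ∧ X (m + 1) ω = z - 1}
      = ⋃ m, ⋃ (_ : m < n), (X m ⁻¹' {z} ∩ X (m + 1) ⁻¹' {z - 1}) := by
    ext ω
    simp only [Set.mem_ofPred_eq, Set.mem_iUnion, Set.mem_inter_iff, Set.mem_preimage,
      Set.mem_singleton_iff, exists_prop]
  rw [this]
  refine MeasurableSet.iUnion fun m => MeasurableSet.iUnion fun hm => MeasurableSet.inter ?_ ?_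
  · exact h.measurable_walk (by omega) (measurableSet_singleton z)
  · exact h.measurable_walk (by omega) (measurableSet_singleton (z - 1))

lemma ae_step (h : IsCookieRWRE P η X) :
    ∀ᵐ ω ∂P, ∀ n, X (n + 1) ω = X n ω + 1 ∨ X (n + 1) ω = X n ω - 1 := by
  filter_upwards [ae_all_iff.2 h.steps] with ω hω n
  rcases (abs_eq zero_le_one).1 (hω n) with h1 | h1
  · left; omega
  · right; omega

/-- Conditional expectation of a two-valued function of the next step. -/
lemma condExp_step [IsProbabilityMeasure P] (h : IsCookieRWRE P η X) (n : ℕ) {U D F : Ω → ℝ}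
    (hU : Measurable[h.filtration n] U) (hD : Measurable[h.filtration n] D)
    (hUi : Integrable U P) (hDi : Integrable D P)
    (hF1 : ∀ᵐ ω ∂P, X (n + 1) ω = X n ω + 1 → F ω = U ω)
    (hF2 : ∀ᵐ ω ∂P, X (n + 1) ω = X n ω - 1 → F ω = D ω) :
    Integrable F P ∧ P[F | h.filtration n] =ᵐ[P] fun ω =>
      currentEnv η X n ω (X n ω) * U ω + (1 - currentEnv η X n ω (X n ω)) * D ω := by
  set R : Set Ω := {ω | X (n + 1) ω = X n ω + 1} with hR
  set I : Ω → ℝ := R.indicator fun _ => (1 : ℝ) with hI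
  have hRm : MeasurableSet R := measurableSet_eq_fun (h.meas _) ((h.meas n).add_const 1)
  have hIi : Integrable I P := (integrable_const 1).indicator hRm
  have hUDi : Integrable (fun ω => (U ω - D ω) * I ω) P := by
    have : (fun ω => (U ω - D ω) * I ω) = R.indicator fun ω => U ω - D ω := by
      funext ω
      by_cases hω : ω ∈ R <;> simp [hI, hω]
    rw [this]
    exact (hUi.sub hDi).indicator hRm
  have hFeq : F =ᵐ[P] (fun ω => D ω) + fun ω => (U ω - D ω) * I ω := by
    filter_upwards [hF1, hF2, h.ae_step] with ω h1 h2 hs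
    by_cases hω : ω ∈ R
    · simp [hI, hω, h1 hω]
    · simp [hI, hω, h2 ((hs n).resolve_left hω)]
  have hUDs : StronglyMeasurable[h.filtration n] fun ω => U ω - D ω :=
    (hU.sub hD).stronglyMeasurable
  refine ⟨(hDi.add hUDi).congr hFeq.symm, ?_⟩
  have e1 : P[fun ω => (U ω - D ω) * I ω | h.filtration n]
      =ᵐ[P] (fun ω => U ω - D ω) * P[I | h.filtration n] :=
    condExp_mul_of_stronglyMeasurable_left hUDs hUDi hIi
  have e2 : P[D | h.filtration n] = D :=
    condExp_of_stronglyMeasurable (h.filtration.le n) hD.stronglyMeasurable hDi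
  filter_upwards [condExp_congr_ae (m := h.filtration n) hFeq,
    condExp_add hDi hUDi (h.filtration n), e1, h.cond n] with ω a1 a2 a3 a4
  rw [a1, a2, Pi.add_apply, a3, Pi.mul_apply]
  rw [currentEnv_self] at a4
  change _ + _ * (P[I | h.filtration n]) ω = _
  have a4' : (P[I | h.filtration n]) ω = currentEnv η X n ω (X n ω) := a4
  rw [a4']
  have e2' : (P[fun ω => D ω | h.filtration n]) ω = D ω := congrFun e2 ω
  rw [e2']
  ring

/-- Conditional probability, given the past, that the walk visits `(-∞, b]` from time `n` on. -/
def hitPotential (η : Ω → ℤ → ℝ) (X : ℕ → Ω → ℤ) (b : ℤ) (n : ℕ) (ω : Ω) : ℝ :=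
  (hitProb (currentEnv η X n ω) b (X n ω)).toReal

lemma hitPotential_nonneg (b : ℤ) (n : ℕ) (ω : Ω) : 0 ≤ hitPotential η X b n ω :=
  ENNReal.toReal_nonneg

lemma hitPotential_le_one (b : ℤ) (n : ℕ) (ω : Ω) : hitPotential η X b n ω ≤ 1 :=
  ENNReal.toReal_le_of_le_ofReal zero_le_one (by simpa using hitProb_le_one _ _ _)

lemma hitPotential_eq_one {b : ℤ} {n : ℕ} {ω : Ω} (h : X n ω ≤ b) : hitPotential η X b n ω = 1 := by
  rw [hitPotential, hitProb_eq_one _ h, ENNReal.toReal_one]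

lemma supermartingale_hitPotential [IsProbabilityMeasure P] (h : IsCookieRWRE P η X) (b : ℤ) :
    Supermartingale (hitPotential η X b) h.filtration P := by
  have hmeas : ∀ n, Measurable[h.filtration n] (hitPotential η X b n) := fun n =>
    ENNReal.measurable_toReal.comp ((measurable_hitProb b).comp
      ((h.measurable_currentEnv n).prodMk (h.measurable_walk le_rfl)))
  have hint : ∀ {n : ℕ} {e : Ω → ℤ → ℝ} {y : Ω → ℤ},
      Measurable[h.filtration n] (fun ω => (hitProb (e ω) b (y ω)).toReal) →
      Integrable (fun ω => (hitProb (e ω) b (y ω)).toReal) P := fun {n e y} hm =>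
    Integrable.of_bound ((hm.mono (h.filtration.le n) le_rfl).aestronglyMeasurable) 1
      (ae_of_all _ fun ω => by
        rw [Real.norm_of_nonneg ENNReal.toReal_nonneg]
        exact ENNReal.toReal_le_of_le_ofReal zero_le_one (by simpa using hitProb_le_one _ _ _))
  refine supermartingale_nat (fun n => (hmeas n).stronglyMeasurable) (fun n => hint (hmeas n))
    fun n => ?_
  set U : Ω → ℝ := fun ω => (hitProb (currentEnv η X n ω) b (X n ω + 1)).toReal with hU
  set D : Ω → ℝ := fun ω =>
    (hitProb (Function.update (currentEnv η X n ω) (X n ω) (1 / 2)) b (X n ω - 1)).toReal with hD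
  have hX : Measurable[h.filtration n] (X n) := h.measurable_walk le_rfl
  have hE := h.measurable_currentEnv n
  have hUm : Measurable[h.filtration n] U :=
    ENNReal.measurable_toReal.comp ((measurable_hitProb b).comp (hE.prodMk (hX.add_const 1)))
  have hupd : Measurable fun p : (ℤ → ℝ) × ℤ => Function.update p.1 p.2 (1 / 2 : ℝ) :=
    measurable_from_prod_countable_left fun y => measurable_update_left
  have hDm : Measurable[h.filtration n] D :=
    ENNReal.measurable_toReal.comp ((measurable_hitProb b).comp
      ((hupd.comp (hE.prodMk hX)).prodMk (hX.sub_const 1)))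
  obtain ⟨-, hc⟩ := h.condExp_step n (F := hitPotential η X b (n + 1)) hUm hDm (hint hUm)
    (hint hDm)
    (ae_of_all _ fun ω hω => by rw [hitPotential, currentEnv_succ_of_right η X hω, hω])
    (ae_of_all _ fun ω hω => by rw [hitPotential, currentEnv_succ_of_left η X hω, hω])
  filter_upwards [hc, h.envRange] with ω hω hr
  rw [hω]
  have hq := currentEnv_mem X n hr (X n ω)
  set q := currentEnv η X n ω (X n ω) with hqdef
  have hq0 : 0 ≤ q := by linarith [hq.1]
  have hq1 : 0 ≤ 1 - q := by linarith [hq.2]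
  rcases le_or_gt (X n ω) b with hb | hb
  · rw [hitPotential_eq_one hb]
    have hU1 : U ω ≤ 1 :=
      ENNReal.toReal_le_of_le_ofReal zero_le_one (by simpa using hitProb_le_one _ _ _)
    have hD1 : D ω ≤ 1 :=
      ENNReal.toReal_le_of_le_ofReal zero_le_one (by simpa using hitProb_le_one _ _ _)
    nlinarith
  · refine le_of_eq ?_
    rw [hitPotential, hitProb_step _ hb, ← hqdef, ENNReal.toReal_add, ENNReal.toReal_mul,
      ENNReal.toReal_mul, ENNReal.toReal_ofReal hq0, ← ENNReal.ofReal_one,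
      ← ENNReal.ofReal_sub _ hq0, ENNReal.toReal_ofReal hq1]
    · exact ENNReal.mul_ne_top ENNReal.ofReal_ne_top
        (ne_top_of_le_ne_top ENNReal.one_ne_top (hitProb_le_one _ _ _))
    · exact ENNReal.mul_ne_top (by simp)
        (ne_top_of_le_ne_top ENNReal.one_ne_top (hitProb_le_one _ _ _))

lemma ae_exists_tendsto_hitPotential [IsProbabilityMeasure P] (h : IsCookieRWRE P η X) (b : ℤ) :
    ∀ᵐ ω ∂P, ∃ c, Tendsto (fun n => hitPotential η X b n ω) atTop (nhds c) := by
  have hs := (h.supermartingale_hitPotential b).neg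
  have hb : ∀ n, eLpNorm ((-hitPotential η X b) n) 1 P ≤ (1 : NNReal) := fun n => by
    refine (eLpNorm_le_of_ae_bound (C := 1) (ae_of_all _ fun ω => ?_)).trans (by simp)
    rw [Pi.neg_apply, Pi.neg_apply, norm_neg, Real.norm_of_nonneg (hitPotential_nonneg _ _ _)]
    exact hitPotential_le_one _ _ _
  filter_upwards [hs.exists_ae_tendsto_of_bdd hb] with ω ⟨c, hc⟩
  exact ⟨-c, by simpa using hc.neg⟩

lemma ae_not_bddAbove [IsProbabilityMeasure P] (h : IsCookieRWRE P η X)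
    (hX0 : ∀ᵐ ω ∂P, X 0 ω = 1) :
    ∀ᵐ ω ∂P, ∀ N : ℤ, ∃ n, N ≤ X n ω := by
  have hXm : ∀ n, Measurable[h.filtration n] fun ω => (X n ω : ℝ) := fun n =>
    (measurable_from_top (f := fun z : ℤ => (z : ℝ))).comp (h.measurable_walk le_rfl)
  have hstep : ∀ n, Integrable (fun ω => (X n ω : ℝ)) P →
      Integrable (fun ω => (X (n + 1) ω : ℝ)) P ∧
      P[fun ω => (X (n + 1) ω : ℝ) | h.filtration n] =ᵐ[P] fun ω =>
        currentEnv η X n ω (X n ω) * ((X n ω : ℝ) + 1)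
          + (1 - currentEnv η X n ω (X n ω)) * ((X n ω : ℝ) - 1) := fun n hi =>
    h.condExp_step n ((hXm n).add_const 1) ((hXm n).sub_const 1)
      (hi.add (integrable_const 1)) (hi.sub (integrable_const 1))
      (ae_of_all _ fun ω hω => by rw [hω]; push_cast; ring)
      (ae_of_all _ fun ω hω => by rw [hω]; push_cast; ring)
  have hint : ∀ n, Integrable (fun ω => (X n ω : ℝ)) P := by
    intro n
    induction n with
    | zero =>
      exact (integrable_const (1 : ℝ)).congr (hX0.mono fun ω hω => by simp [hω])
    | succ n ih => exact (hstep n ih).1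
  have hsub : Submartingale (fun n ω => (X n ω : ℝ)) h.filtration P := by
    refine submartingale_nat (fun n => (hXm n).stronglyMeasurable) hint fun n => ?_
    filter_upwards [(hstep n (hint n)).2, h.envRange] with ω hω hr
    rw [hω]
    linarith [(currentEnv_mem X n hr (X n ω)).1]
  have hbdd : ∀ᵐ ω ∂P, ∀ i, |(X (i + 1) ω : ℝ) - X i ω| ≤ (1 : NNReal) := by
    filter_upwards [ae_all_iff.2 h.steps] with ω hω i
    have := hω i
    rw [NNReal.coe_one]
    exact_mod_cast this.le
  filter_upwards [hsub.bddAbove_iff_exists_tendsto hbdd, h.ae_step] with ω hω hs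
  by_contra! hN
  obtain ⟨N, hN⟩ := hN
  obtain ⟨c, hc⟩ := hω.1 ⟨(N : ℝ), by
    rintro _ ⟨n, rfl⟩
    change (X n ω : ℝ) ≤ N
    exact_mod_cast (hN n).le⟩
  have hd := ((tendsto_add_atTop_iff_nat 1).2 hc).sub hc
  rw [sub_self] at hd
  obtain ⟨n, hn⟩ := (hd.eventually (Metric.ball_mem_nhds (0 : ℝ) one_pos)).exists
  rw [Real.dist_eq, sub_zero] at hn
  rcases hs n with h1 | h1 <;> rw [h1] at hn <;> push_cast at hn <;> simp at hn

/-- Pathwise upper bound for the return potential at the first visit to a new maximum. -/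
lemma hitPotential_le_of_forall_lt {b N : ℤ} {n : ℕ} {ω : Ω} (hN : X n ω = N)
    (hlt : ∀ m < n, X m ω < N) (hb : b < N) :
    hitPotential η X b n ω ≤ (extLim fun x => η ω (x + N)).toReal := by
  refine ENNReal.toReal_mono (ne_top_of_le_ne_top ENNReal.one_ne_top (extLim_le_one _)) ?_
  rw [hN]
  refine (hitProb_mono_left _ N (show b ≤ N - 1 by omega)).trans (le_of_eq ?_)
  have hfresh : ∀ w, N ≤ w → currentEnv η X n ω w = η ω w := fun w hw => by
    rw [currentEnv, if_neg]
    rintro ⟨m, hm, h1, -⟩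
    have := hlt m hm
    omega
  rw [← hitProb_pred_eq_extLim]
  exact iSup_congr fun m => returnProb_congr m 0 (fun w hw => hfresh w (by omega)) fun _ _ => Iff.rfl

lemma exists_first_visit {x : ℕ → ℤ} (hstep : ∀ n, x (n + 1) = x n + 1 ∨ x (n + 1) = x n - 1)
    {N : ℤ} (h0 : x 0 < N) (hN : ∃ n, N ≤ x n) : ∃ n, x n = N ∧ ∀ m < n, x m < N := by
  classical
  have hmin : ∀ m < Nat.find hN, x m < N := fun m hm => not_le.1 (Nat.find_min hN hm)
  refine ⟨Nat.find hN, ?_, hmin⟩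
  have hspec := Nat.find_spec hN
  rcases hf : Nat.find hN with _ | k
  · rw [hf] at hspec
    omega
  · rw [hf] at hspec hmin
    have := hmin k (by omega)
    rcases hstep k with h1 | h1 <;> omega

lemma tendsto_atTop_of_potential {ω : Ω}
    (hstep : ∀ n, X (n + 1) ω = X n ω + 1 ∨ X (n + 1) ω = X n ω - 1) (h0 : X 0 ω = 1)
    (hunb : ∀ N : ℤ, ∃ n, N ≤ X n ω)
    (hconv : ∀ b : ℤ, ∃ c, Tendsto (fun n => hitPotential η X b n ω) atTop (nhds c))
    (hgood : ∃ c < 1, ∃ᶠ n : ℕ in atTop, extLim (fun x => η ω (x + n)) ≤ c) :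
    Tendsto (fun n => X n ω) atTop atTop := by
  by_contra hnot
  rw [tendsto_atTop] at hnot
  push Not at hnot
  obtain ⟨b, hb⟩ := hnot
  obtain ⟨l, hl⟩ := hconv b
  obtain ⟨c, hc1, hc⟩ := hgood
  have hl1 : 1 ≤ l := by
    refine ge_of_tendsto_of_frequently hl (hb.mono fun n hn => ?_)
    exact (hitPotential_eq_one hn.le).ge
  have hup : ∀ n, X n ω ≤ n + 1 := by
    intro n
    induction n with
    | zero => simp [h0]
    | succ n ih => rcases hstep n with h1 | h1 <;> push_cast <;> omega
  have hlc : l ≤ c.toReal := by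
    refine le_of_tendsto_of_frequently hl (frequently_atTop.2 fun a => ?_)
    obtain ⟨N, hN, hNc⟩ := frequently_atTop.1 hc (a + 2 + b.toNat)
    obtain ⟨n, hn, hlt⟩ := exists_first_visit (x := fun n => X n ω) hstep (N := N)
      (by simp only [h0]; omega) (hunb N)
    refine ⟨n, ?_, ?_⟩
    · have := hup n
      omega
    · exact (hitPotential_le_of_forall_lt hn hlt (by omega)).trans
        (ENNReal.toReal_mono hc1.ne_top hNc)
  have : c.toReal < 1 := by
    rw [← ENNReal.toReal_one]
    exact (ENNReal.toReal_lt_toReal hc1.ne_top ENNReal.one_ne_top).2 hc1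
  linarith

lemma measurableSet_visited (h : IsCookieRWRE P η X) (n : ℕ) :
    MeasurableSet[h.filtration n] {ω | ∃ m ≤ n, X m ω = 0} := by
  have : {ω | ∃ m ≤ n, X m ω = 0} = ⋃ m, ⋃ (_ : m ≤ n), X m ⁻¹' {0} := by
    ext ω
    simp
  rw [this]
  exact MeasurableSet.iUnion fun m => MeasurableSet.iUnion fun hm =>
    h.measurable_walk hm (measurableSet_singleton 0)

/-- Integrated maximal inequality for the return potential of the origin. -/
lemma measureReal_visited_inter_le [IsProbabilityMeasure P] (h : IsCookieRWRE P η X)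
    {B : Set Ω} (hB : MeasurableSet[MeasurableSpace.comap η inferInstance] B) (n : ℕ) :
    P.real (B ∩ {ω | ∃ m ≤ n, X m ω = 0}) ≤ ∫ ω in B, hitPotential η X 0 0 ω ∂P := by
  have hs := h.supermartingale_hitPotential 0
  have hBn : ∀ n, MeasurableSet[h.filtration n] B := fun n =>
    (le_sup_left : MeasurableSpace.comap η inferInstance ≤ h.filtration n) B hB
  set V : ℕ → Set Ω := fun n => {ω | ∃ m ≤ n, X m ω = 0} with hV
  have hVm : ∀ n, MeasurableSet (V n) := fun n =>
    h.filtration.le n _ (h.measurableSet_visited n)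
  have hBm : MeasurableSet B := h.filtration.le 0 _ (hBn 0)
  have hi : ∀ n, Integrable (hitPotential η X 0 n) P := hs.integrable
  have hsplit : ∀ n (C : Set Ω), MeasurableSet C → P.real (C ∩ V n)
      + ∫ ω in C \ V n, hitPotential η X 0 n ω ∂P
      = ∫ ω in C, (if ω ∈ V n then 1 else hitPotential η X 0 n ω) ∂P := by
    classical
    intro n C hC
    have hint : Integrable (fun ω => if ω ∈ V n then 1 else hitPotential η X 0 n ω) P := by
      have := Integrable.piecewise (s := V n) (hVm n)
        (integrable_const (μ := P) (1 : ℝ)).integrableOn (hi n).integrableOn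
      exact this
    rw [← integral_inter_add_sdiff (hVm n) hint.integrableOn]
    congr 1
    · rw [setIntegral_congr_fun (g := fun _ => (1 : ℝ)) (hC.inter (hVm n))
        fun ω hω => if_pos hω.2]
      simp
    · exact setIntegral_congr_fun (hC.diff (hVm n)) fun ω hω => (if_neg hω.2).symm
  suffices hmain : P.real (B ∩ V n) + ∫ ω in B \ V n, hitPotential η X 0 n ω ∂P
      ≤ ∫ ω in B, hitPotential η X 0 0 ω ∂P by
    have : 0 ≤ ∫ ω in B \ V n, hitPotential η X 0 n ω ∂P :=
      integral_nonneg fun ω => hitPotential_nonneg _ _ _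
    linarith
  induction n with
  | zero =>
    rw [hsplit 0 B hBm]
    refine le_of_eq (setIntegral_congr_fun hBm fun ω _ => ?_)
    split_ifs with hω
    · obtain ⟨m, hm, h0⟩ := hω
      obtain rfl : m = 0 := by omega
      exact (hitPotential_eq_one h0.le).symm
    · rfl
  | succ n ih =>
    refine le_trans ?_ ih
    have hsub : V n ⊆ V (n + 1) := fun ω ⟨m, hm, h0⟩ => ⟨m, by omega, h0⟩
    have hdm : MeasurableSet[h.filtration n] (B \ V n) :=
      (hBn n).diff (h.measurableSet_visited n)
    have h1 := hs.setIntegral_le (Nat.le_succ n) hdm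
    refine le_trans (le_of_eq ?_) (add_le_add le_rfl h1)
    have h2 : P.real (B ∩ V (n + 1)) = P.real (B ∩ V n) + P.real ((B \ V n) ∩ V (n + 1)) := by
      rw [← measureReal_union]
      · congr 1
        ext ω
        have := @hsub ω
        simp only [Set.mem_inter_iff, Set.mem_union, Set.mem_sdiff]
        tauto
      · exact Set.disjoint_left.2 fun ω h1 h2 => h2.1.2 h1.2
      · exact (hBm.diff (hVm n)).inter (hVm (n + 1))
    have h3 : B \ V (n + 1) = (B \ V n) \ V (n + 1) := by
      ext ω
      have := @hsub ω
      simp only [Set.mem_sdiff]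
      tauto
    rw [h2, h3, add_assoc, hsplit (n + 1) _ (hBm.diff (hVm n))]
    congr 1
    refine setIntegral_congr_fun (hBm.diff (hVm n)) fun ω hω => ?_
    split_ifs with hω'
    · obtain ⟨m, hm, h0⟩ := hω'
      have hmn : m = n + 1 := by
        by_contra hne
        exact hω.2 ⟨m, by omega, h0⟩
      subst hmn
      exact (hitPotential_eq_one h0.le).symm
    · rfl

lemma hitTime_eq_top_iff {ω : Ω} : hitTime X 0 ω = ⊤ ↔ ∀ n, X n ω ≠ 0 := by
  simp [hitTime, iInf_eq_top]

lemma ae_condExp_hitTime_pos [IsProbabilityMeasure P] (h : IsCookieRWRE P η X)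
    (hpot : ∀ᵐ ω ∂P, hitPotential η X 0 0 ω < 1) :
    ∀ᵐ ω ∂P, 0 < (P[Set.indicator {ω' | hitTime X 0 ω' = ⊤} (fun _ => (1 : ℝ)) |
        MeasurableSpace.comap η inferInstance]) ω := by
  have hle : MeasurableSpace.comap η inferInstance ≤ mΩ := h.envMeas.comap_le
  set A : Set Ω := {ω' | hitTime X 0 ω' = ⊤} with hA
  have hAc : Aᶜ = ⋃ n, {ω | ∃ m ≤ n, X m ω = 0} := by
    ext ω
    simp only [hA, Set.mem_compl_iff, Set.mem_ofPred_eq, hitTime_eq_top_iff, Set.mem_iUnion]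
    push Not
    exact ⟨fun ⟨n, hn⟩ => ⟨n, n, le_rfl, hn⟩, fun ⟨_, m, _, hm⟩ => ⟨m, hm⟩⟩
  have hAm : MeasurableSet A := by
    rw [← MeasurableSet.compl_iff, hAc]
    exact MeasurableSet.iUnion fun n => h.filtration.le n _ (h.measurableSet_visited n)
  set f := P[A.indicator (fun _ => (1 : ℝ)) | MeasurableSpace.comap η inferInstance] with hf
  set B : Set Ω := {ω | f ω ≤ 0} with hBdef
  have hB : MeasurableSet[MeasurableSpace.comap η inferInstance] B :=
    (stronglyMeasurable_condExp (f := A.indicator fun _ => (1 : ℝ)) (μ := P)).measurable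
      (measurableSet_Iic (a := (0 : ℝ)))
  have hBm : MeasurableSet B := hle _ hB
  have hAi : Integrable (A.indicator fun _ => (1 : ℝ)) P := (integrable_const 1).indicator hAm
  have hBA : P.real (B ∩ A) = 0 := by
    have h1 : ∫ ω in B, f ω ∂P = P.real (B ∩ A) := by
      rw [hf, setIntegral_condExp hle hAi hB, setIntegral_indicator hAm]
      simp
    have h2 : ∫ ω in B, f ω ∂P ≤ 0 := setIntegral_nonpos hBm fun ω hω => hω
    exact le_antisymm (h1 ▸ h2) measureReal_nonneg
  have hlim : P.real (B ∩ Aᶜ) ≤ ∫ ω in B, hitPotential η X 0 0 ω ∂P := by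
    have hmono : Monotone fun n => B ∩ {ω | ∃ m ≤ n, X m ω = 0} :=
      fun n n' hn ω hω => ⟨hω.1, hω.2.imp fun m hm => ⟨hm.1.trans hn, hm.2⟩⟩
    have ht := tendsto_measure_iUnion_atTop (μ := P) hmono
    rw [← Set.inter_iUnion, ← hAc] at ht
    exact le_of_tendsto ((ENNReal.tendsto_toReal (measure_ne_top _ _)).comp ht)
      (Eventually.of_forall fun n => h.measureReal_visited_inter_le hB n)
  have hPB : P.real B = P.real (B ∩ A) + P.real (B ∩ Aᶜ) := by
    rw [← Set.sdiff_eq]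
    exact (measureReal_inter_add_sdiff hAm).symm
  have hpi : Integrable (hitPotential η X 0 0) P :=
    (h.supermartingale_hitPotential 0).integrable 0
  have hzero : ∫ ω in B, (1 - hitPotential η X 0 0 ω) ∂P = 0 := by
    refine le_antisymm ?_ (integral_nonneg fun ω => sub_nonneg.2 (hitPotential_le_one _ _ _))
    rw [integral_sub (integrable_const _) hpi.integrableOn]
    simp only [integral_const, measureReal_restrict_apply_univ, smul_eq_mul, mul_one]
    linarith
  rw [setIntegral_eq_zero_iff_of_nonneg_ae
    (ae_of_all _ fun ω => sub_nonneg.2 (hitPotential_le_one _ _ _))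
    ((integrable_const _).sub hpi).integrableOn] at hzero
  filter_upwards [(ae_restrict_iff' hBm).1 hzero, hpot] with ω h1 h2
  by_contra hω
  have := h1 (not_lt.1 hω)
  simp only [Pi.zero_apply] at this
  linarith

end IsCookieRWRE

/-- In a stationary ergodic environment with `E[ω(0)/(1-ω(0))] > 2` (possibly infinite),
the walk tends to `+∞` a.s. and the quenched probability of never hitting `0` is a.s.
positive. -/
theorem stmt8 {Ω : Type*} [MeasurableSpace Ω] (P : Measure Ω) [IsProbabilityMeasure P]
    (η : Ω → ℤ → ℝ) (X : ℕ → Ω → ℤ) (h : IsCookieRWRE P η X)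
    (hX0 : ∀ᵐ ω ∂P, X 0 ω = 1)
    (herg : Ergodic (fun ω : ℤ → ℝ => fun x => ω (x + 1)) (P.map η))
    (hexp : 2 < ∫⁻ ω, ENNReal.ofReal (ω 0 / (1 - ω 0)) ∂(P.map η)) :
    (∀ᵐ ω ∂P, Tendsto (fun n => X n ω) atTop atTop) ∧
    ∀ᵐ ω ∂P, 0 < (P[Set.indicator {ω' | hitTime X 0 ω' = ⊤} (fun _ => (1 : ℝ)) |
        MeasurableSpace.comap η inferInstance]) ω := by
  have : IsProbabilityMeasure (P.map η) := Measure.isProbabilityMeasure_map h.envMeas.aemeasurable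
  have hset : MeasurableSet {e : ℤ → ℝ | ∀ x, e x ∈ Set.Ico (1 / 2 : ℝ) 1} := by
    have : {e : ℤ → ℝ | ∀ x, e x ∈ Set.Ico (1 / 2 : ℝ) 1}
        = ⋂ x, (fun e : ℤ → ℝ => e x) ⁻¹' Set.Ico (1 / 2 : ℝ) 1 := by
      ext e
      simp
    rw [this]
    exact MeasurableSet.iInter fun x => measurable_pi_apply x measurableSet_Ico
  have hlt := ae_extLim_lt_one herg ((ae_map_iff h.envMeas.aemeasurable hset).2 h.envRange) hexp
  have hgood := ae_of_ae_map h.envMeas.aemeasurable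
    (ae_exists_frequently_extLim_le herg.toMeasurePreserving hlt)
  have hshift := ae_of_ae_map h.envMeas.aemeasurable
    (herg.toMeasurePreserving.quasiMeasurePreserving.ae hlt)
  constructor
  · filter_upwards [h.ae_step, hX0, h.ae_not_bddAbove hX0,
      ae_all_iff.2 h.ae_exists_tendsto_hitPotential, hgood] with ω h1 h2 h3 h4 h5
    exact IsCookieRWRE.tendsto_atTop_of_potential h1 h2 h3 h4 h5
  · refine h.ae_condExp_hitTime_pos ?_
    filter_upwards [hX0, hshift] with ω h1 h2
    have h3 : hitProb (η ω) 0 1 = extLim fun x => η ω (x + 1) := by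
      simpa using hitProb_pred_eq_extLim (η ω) 1
    rw [IsCookieRWRE.hitPotential, currentEnv_zero, h1, h3, ← ENNReal.toReal_one]
    exact (ENNReal.toReal_lt_toReal h2.ne_top ENNReal.one_ne_top).2 h2
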